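/- In 𝓕, let v := -3•⁅e₁,⁅e₂,⁅e₁,⁅e₂,e₃⁆⁆⁆⁆ + ⁅e₂,⁅e₁,⁅e₁,⁅e₂,e₃⁆⁆⁆⁆ (that is, v = -3·e₍₁₂₁₂₃₎ + e₍₂₁₁₂₃₎ in multibracket notation). Then ⁅f₂, v⁆ = 0 and ⁅⁅f₁,⁅f₁,⁅f₂,f₃⁆⁆⁆, v⁆ = 0; equivalently ⁅F₁, v⁆ = 0 = ⁅F₂, v⁆, so v is a lowest-weight vector for 𝓕ib of weight -ρ = β₁ + β₂. -/

import Mathlib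

/-! Statement 18: v := -3·e₍₁₂₁₂₃₎ + e₍₂₁₁₂₃₎ is a lowest-weight vector for 𝓕ib in 𝓕:
⁅F₁, v⁆ = 0 = ⁅F₂, v⁆ (equivalently ⁅f₂, v⁆ = 0 and ⁅⁅f₁,⁅f₁,⁅f₂,f₃⁆⁆⁆, v⁆ = 0). -/

noncomputable section

open CartanMatrix

/-- The generalized Cartan matrix of the rank 3 hyperbolic Kac-Moody algebra 𝓕. -/
def Amat : Matrix (Fin 3) (Fin 3) ℤ := !![2, -2, 0; -2, 2, -1; 0, -1, 2]

/-- The rank 3 hyperbolic Kac-Moody algebra 𝓕 over ℚ. -/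
abbrev 𝓕 : Type := Matrix.ToLieAlgebra ℚ Amat

/-- The Chevalley generator eᵢ of 𝓕 (index `i : Fin 3`, with `e 0 = e₁`, etc.). -/
def e (i : Fin 3) : 𝓕 :=
  LieSubmodule.Quotient.mk (N := Relations.toIdeal ℚ Amat)
    (FreeLieAlgebra.of ℚ (Generators.E i))

/-- The Chevalley generator fᵢ of 𝓕. -/
def f (i : Fin 3) : 𝓕 :=
  LieSubmodule.Quotient.mk (N := Relations.toIdeal ℚ Amat)
    (FreeLieAlgebra.of ℚ (Generators.F i))

/-- The Chevalley generator hᵢ of 𝓕. -/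
def h (i : Fin 3) : 𝓕 :=
  LieSubmodule.Quotient.mk (N := Relations.toIdeal ℚ Amat)
    (FreeLieAlgebra.of ℚ (Generators.H i))

/-- E₁ := (1/2)•⁅e₁,⁅e₁,⁅e₂,e₃⁆⁆⁆. -/
def E₁ : 𝓕 := (1/2 : ℚ) • ⁅e 0, ⁅e 0, ⁅e 1, e 2⁆⁆⁆

/-- E₂ := e₂. -/
def E₂ : 𝓕 := e 1

/-- F₁ := -(1/2)•⁅f₁,⁅f₁,⁅f₂,f₃⁆⁆⁆. -/
def F₁ : 𝓕 := -((1/2 : ℚ) • ⁅f 0, ⁅f 0, ⁅f 1, f 2⁆⁆⁆)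

/-- F₂ := f₂. -/
def F₂ : 𝓕 := f 1

/-- H₁ := 2h₁ + h₂ + h₃. -/
def H₁ : 𝓕 := (2 : ℚ) • h 0 + h 1 + h 2

/-- H₂ := h₂. -/
def H₂ : 𝓕 := h 1

/-- v = -3·e₍₁₂₁₂₃₎ + e₍₂₁₁₂₃₎ (right-nested multibrackets, indices 1,2,3 ↦ 0,1,2). -/
def v : 𝓕 :=
  (-3 : ℚ) • ⁅e 0, ⁅e 1, ⁅e 0, ⁅e 1, e 2⁆⁆⁆⁆ + ⁅e 1, ⁅e 0, ⁅e 0, ⁅e 1, e 2⁆⁆⁆⁆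

open CartanMatrix.Relations in
theorem quotient_mk_eq_zero_of_mem_toSet {x : FreeLieAlgebra ℚ (Generators (Fin 3))}
    (hx : x ∈ toSet ℚ Amat) : (LieSubmodule.Quotient.mk (N := toIdeal ℚ Amat) x : 𝓕) = 0 :=
  (LieSubmodule.Quotient.mk_eq_zero' (N := toIdeal ℚ Amat)).2 (LieSubmodule.subset_lieSpan hx)

theorem lie_e_f_self (i : Fin 3) : ⁅e i, f i⁆ = h i := by
  have := quotient_mk_eq_zero_of_mem_toSet
    (.inl <| .inl <| .inl <| .inl <| .inr ⟨(i, i), rfl⟩)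
  simp only [Relations.EF, Function.uncurry, if_true] at this
  exact sub_eq_zero.1 this

theorem lie_f_e_self (i : Fin 3) : ⁅f i, e i⁆ = -h i := by
  rw [← lie_skew, lie_e_f_self]

theorem lie_f_e_of_ne {i j : Fin 3} (hij : i ≠ j) : ⁅f i, e j⁆ = 0 := by
  have := quotient_mk_eq_zero_of_mem_toSet
    (.inl <| .inl <| .inl <| .inl <| .inr ⟨(j, i), rfl⟩)
  simp only [Relations.EF, Function.uncurry, if_neg hij.symm] at this
  rw [← lie_skew, neg_eq_zero]
  exact this

theorem lie_h_e (i j : Fin 3) : ⁅h i, e j⁆ = (Amat i j : ℚ) • e j := by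
  have := quotient_mk_eq_zero_of_mem_toSet
    (.inl <| .inl <| .inl <| .inr ⟨(i, j), rfl⟩)
  rw [Int.cast_smul_eq_zsmul]
  exact sub_eq_zero.1 this

theorem serre_e (i j : Fin 3) :
    (LieAlgebra.ad ℚ 𝓕 (e i) ^ (-Amat i j).toNat) ⁅e i, e j⁆ = 0 := by
  have := quotient_mk_eq_zero_of_mem_toSet (.inl <| .inr ⟨(i, j), rfl⟩)
  refine Eq.trans ?_ this
  simp only [Relations.adE, Function.uncurry]
  induction (-Amat i j).toNat with
  | zero => rfl
  | succ n ih =>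
    rw [pow_succ', pow_succ', Module.End.mul_apply, Module.End.mul_apply, ih]
    rfl

theorem lie_lie_eq_add_smul {L : Type*} [LieRing L] [LieAlgebra ℚ L] {x a b : L} {r s : ℚ}
    (ha : ⁅x, a⁆ = r • a) (hb : ⁅x, b⁆ = s • b) : ⁅x, ⁅a, b⁆⁆ = (r + s) • ⁅a, b⁆ := by
  rw [leibniz_lie, ha, hb, smul_lie, lie_smul, add_smul]

theorem lie_e_zero_e_two : ⁅e 0, e 2⁆ = 0 := by
  simpa [Amat] using serre_e 0 2

theorem lie_e_one_lie_e_one_e_two : ⁅e 1, ⁅e 1, e 2⁆⁆ = 0 := by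
  simpa [Amat] using serre_e 1 2

theorem lie_f_zero_e12 : ⁅f 0, ⁅e 1, e 2⁆⁆ = 0 := by
  simp [leibniz_lie (f 0), lie_f_e_of_ne]

theorem lie_f_zero_e012 : ⁅f 0, ⁅e 0, ⁅e 1, e 2⁆⁆⁆ = (2 : ℚ) • ⁅e 1, e 2⁆ := by
  rw [leibniz_lie, lie_f_e_self, lie_f_zero_e12, neg_lie,
    lie_lie_eq_add_smul (lie_h_e 0 1) (lie_h_e 0 2)]
  simp [Amat]

theorem lie_f_zero_e0012 : ⁅f 0, ⁅e 0, ⁅e 0, ⁅e 1, e 2⁆⁆⁆⁆ = (2 : ℚ) • ⁅e 0, ⁅e 1, e 2⁆⁆ := by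
  rw [leibniz_lie, lie_f_e_self, lie_f_zero_e012, neg_lie, lie_lie_eq_add_smul (lie_h_e 0 0)
    (lie_lie_eq_add_smul (lie_h_e 0 1) (lie_h_e 0 2))]
  simp [Amat]

theorem lie_f_zero_e1012 : ⁅f 0, ⁅e 1, ⁅e 0, ⁅e 1, e 2⁆⁆⁆⁆ = 0 := by
  rw [leibniz_lie, lie_f_e_of_ne (by decide), lie_f_zero_e012]
  simp [lie_e_one_lie_e_one_e_two]

theorem lie_f_zero_v : ⁅f 0, v⁆ = (-4 : ℚ) • ⁅e 1, ⁅e 0, ⁅e 1, e 2⁆⁆⁆ := by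
  rw [v, lie_add, lie_smul, leibniz_lie (f 0) (e 0), lie_f_zero_e1012, leibniz_lie (f 0) (e 1),
    lie_f_zero_e0012, lie_f_e_self, lie_f_e_of_ne (by decide), neg_lie,
    lie_lie_eq_add_smul (lie_h_e 0 1) (lie_lie_eq_add_smul (lie_h_e 0 0)
    (lie_lie_eq_add_smul (lie_h_e 0 1) (lie_h_e 0 2)))]
  simp only [Amat, Matrix.of_apply, Matrix.cons_val, zero_lie, lie_zero, lie_smul]
  push_cast
  module

theorem lie_f_one_e12 : ⁅f 1, ⁅e 1, e 2⁆⁆ = e 2 := by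
  rw [leibniz_lie, lie_f_e_self, lie_f_e_of_ne (by decide), neg_lie, lie_h_e]
  simp [Amat]

theorem lie_f_one_e012 : ⁅f 1, ⁅e 0, ⁅e 1, e 2⁆⁆⁆ = 0 := by
  rw [leibniz_lie, lie_f_e_of_ne (by decide), lie_f_one_e12, lie_e_zero_e_two]
  simp

theorem lie_f_one_e1012 :
    ⁅f 1, ⁅e 1, ⁅e 0, ⁅e 1, e 2⁆⁆⁆⁆ = ⁅e 0, ⁅e 1, e 2⁆⁆ := by
  rw [leibniz_lie, lie_f_one_e012, lie_f_e_self, neg_lie, lie_lie_eq_add_smul (lie_h_e 1 0)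
    (lie_lie_eq_add_smul (lie_h_e 1 1) (lie_h_e 1 2))]
  simp only [Amat, Matrix.of_apply, Matrix.cons_val, lie_zero]
  push_cast
  module

theorem lie_f_one_v : ⁅f 1, v⁆ = 0 := by
  rw [v, lie_add, lie_smul, leibniz_lie (f 1) (e 0), lie_f_one_e1012, leibniz_lie (f 1) (e 1),
    leibniz_lie (f 1) (e 0), lie_f_one_e012, lie_f_e_self, lie_f_e_of_ne (by decide), neg_lie,
    lie_lie_eq_add_smul (lie_h_e 1 0) (lie_lie_eq_add_smul (lie_h_e 1 0)
    (lie_lie_eq_add_smul (lie_h_e 1 1) (lie_h_e 1 2)))]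
  simp only [Amat, Matrix.of_apply, Matrix.cons_val, zero_lie, lie_zero, add_zero]
  push_cast
  module

theorem lie_f_two_e12 : ⁅f 2, ⁅e 1, e 2⁆⁆ = -e 1 := by
  rw [leibniz_lie, lie_f_e_self, lie_f_e_of_ne (by decide), lie_neg, lie_skew, lie_h_e]
  simp [Amat]

theorem lie_f_two_e012 : ⁅f 2, ⁅e 0, ⁅e 1, e 2⁆⁆⁆ = -⁅e 0, e 1⁆ := by
  rw [leibniz_lie, lie_f_two_e12, lie_f_e_of_ne (by decide)]
  simp

theorem lie_f_two_e1012 : ⁅f 2, ⁅e 1, ⁅e 0, ⁅e 1, e 2⁆⁆⁆⁆ = -⁅e 1, ⁅e 0, e 1⁆⁆ := by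
  rw [leibniz_lie, lie_f_two_e012, lie_f_e_of_ne (by decide), zero_lie, zero_add, lie_neg]

theorem lie_f_two_v : ⁅f 2, v⁆ = (2 : ℚ) • ⁅e 0, ⁅e 1, ⁅e 0, e 1⁆⁆⁆ := by
  have comm : ⁅e 1, ⁅e 0, ⁅e 0, e 1⁆⁆⁆ = ⁅e 0, ⁅e 1, ⁅e 0, e 1⁆⁆⁆ := by
    rw [leibniz_lie (e 1), ← lie_skew (e 1) (e 0), neg_lie, lie_self, neg_zero, zero_add]
  rw [v, lie_add, lie_smul, leibniz_lie (f 2) (e 0), lie_f_two_e1012, leibniz_lie (f 2) (e 1),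
    leibniz_lie (f 2) (e 0), lie_f_two_e012, lie_f_e_of_ne (by decide), lie_f_e_of_ne (by decide)]
  simp only [zero_lie, lie_neg, zero_add, comm]
  module

theorem lie_f_one_e01 : ⁅f 1, ⁅e 0, e 1⁆⁆ = (-2 : ℚ) • e 0 := by
  rw [leibniz_lie, lie_f_e_self, lie_f_e_of_ne (by decide), lie_neg, lie_skew, lie_h_e]
  simp [Amat]

theorem lie_f_one_e101 : ⁅f 1, ⁅e 1, ⁅e 0, e 1⁆⁆⁆ = (2 : ℚ) • ⁅e 0, e 1⁆ := by
  rw [leibniz_lie, lie_f_one_e01, lie_f_e_self, neg_lie,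
    lie_lie_eq_add_smul (lie_h_e 1 0) (lie_h_e 1 1), lie_smul, ← lie_skew (e 1) (e 0)]
  simp only [Amat, Matrix.of_apply, Matrix.cons_val]
  push_cast
  module

theorem lie_f12_v : ⁅⁅f 1, f 2⁆, v⁆ = (4 : ℚ) • ⁅e 0, ⁅e 0, e 1⁆⁆ := by
  rw [lie_lie, lie_f_one_v, lie_f_two_v, lie_smul, leibniz_lie (f 1), lie_f_one_e101,
    lie_f_e_of_ne (by decide), zero_lie, lie_zero, lie_smul]
  module

theorem lie_f12_e1012 :
    ⁅⁅f 1, f 2⁆, ⁅e 1, ⁅e 0, ⁅e 1, e 2⁆⁆⁆⁆ = -⁅e 0, e 1⁆ := by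
  rw [lie_lie, lie_f_two_e1012, lie_f_one_e1012, lie_f_two_e012, lie_neg, lie_f_one_e101]
  module

theorem lie_f_zero_e01 : ⁅f 0, ⁅e 0, e 1⁆⁆ = (2 : ℚ) • e 1 := by
  rw [leibniz_lie, lie_f_e_self, lie_f_e_of_ne (by decide), neg_lie, lie_h_e]
  simp [Amat]

theorem lie_f_zero_e001 : ⁅f 0, ⁅e 0, ⁅e 0, e 1⁆⁆⁆ = (2 : ℚ) • ⁅e 0, e 1⁆ := by
  rw [leibniz_lie, lie_f_zero_e01, lie_f_e_self, neg_lie,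
    lie_lie_eq_add_smul (lie_h_e 0 0) (lie_h_e 0 1)]
  simp [Amat]

theorem lie_multibracket_f_v : ⁅⁅f 0, ⁅f 0, ⁅f 1, f 2⁆⁆⁆, v⁆ = 0 := by
  simp only [lie_lie (f 0), lie_f12_v, lie_f_zero_v, lie_smul, lie_sub, lie_f_zero_e001,
    lie_f_zero_e01, lie_f_zero_e1012, lie_f12_e1012, lie_neg, lie_zero]
  module

/-- v is killed by f₂ and by the multibracket ⁅f₁,⁅f₁,⁅f₂,f₃⁆⁆⁆; equivalently
⁅F₁, v⁆ = 0 = ⁅F₂, v⁆, so v is a lowest-weight vector for 𝓕ib of weight -ρ = β₁ + β₂. -/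
theorem lowest_weight_vector_neg_rho :
    ⁅f 1, v⁆ = 0 ∧ ⁅⁅f 0, ⁅f 0, ⁅f 1, f 2⁆⁆⁆, v⁆ = 0 ∧
    ⁅F₁, v⁆ = 0 ∧ ⁅F₂, v⁆ = 0 := by
  refine ⟨lie_f_one_v, lie_multibracket_f_v, ?_, lie_f_one_v⟩
  rw [F₁, neg_lie, smul_lie, lie_multibracket_f_v, smul_zero, neg_zero]

end
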